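/- Let K = max_{1≤i≤N} Σ_{j=1}^N |F(ω_ij)| and assume g·λ·K < 1. Then the origin is globally exponentially stable: every solution x : [0,∞) → ℝ^N of the autonomous Hopfield network satisfies max_i |x_i(t)| ≤ e^{−(1−gλK)·t} · max_i |x_i(0)| for all t ≥ 0; in particular every solution converges to 0, so the point 0 is the only attractor. -/

import Mathlib

open Real Filter

noncomputable def F (lam s : ℝ) : ℝ := (2 / Real.pi) * Real.arctan (lam * Real.pi * s / 2)

noncomputable def u (N : ℕ) (lam g : ℝ) (ω : Fin N → Fin N → ℝ) (x : Fin N → ℝ) (i : Fin N) : ℝ :=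
  -x i + g * ∑ j, F lam (ω i j) * F lam (x j)

theorem hop_abs_arctan_le (z : ℝ) : |Real.arctan z| ≤ |z| := by
  have key : ∀ z : ℝ, 0 ≤ z → Real.arctan z ≤ z := by
    intro z hz
    have h := Real.le_tan (Real.arctan_nonneg.mpr hz) (Real.arctan_lt_pi_div_two z)
    rwa [Real.tan_arctan] at h
  rcases le_total 0 z with hz | hz
  · rw [abs_of_nonneg hz, abs_of_nonneg (Real.arctan_nonneg.mpr hz)]
    exact key z hz
  · rw [abs_of_nonpos hz, abs_of_nonpos (Real.arctan_le_zero.mpr hz), ← Real.arctan_neg]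
    exact key (-z) (by linarith)

theorem hop_abs_F_le (lam s : ℝ) (hlam : 0 < lam) : |F lam s| ≤ lam * |s| := by
  have hpi := Real.pi_pos
  unfold F
  rw [abs_mul, abs_of_pos (by positivity : (0 : ℝ) < 2 / Real.pi)]
  calc (2 / Real.pi) * |Real.arctan (lam * Real.pi * s / 2)|
      ≤ (2 / Real.pi) * |lam * Real.pi * s / 2| := by
        exact mul_le_mul_of_nonneg_left (hop_abs_arctan_le _) (by positivity)
    _ = lam * |s| := by
        rw [abs_div, abs_mul, abs_mul, abs_of_pos hlam, abs_of_pos hpi,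
          abs_of_pos (by norm_num : (0 : ℝ) < 2)]
        field_simp

/-- If g·λ·K < 1 with K = max_i Σ_j |F(ω_ij)|, the origin is globally
exponentially stable: max_i |x_i(t)| ≤ e^{−(1−gλK)t}·max_i |x_i(0)|, and every
solution converges to 0. -/
theorem hopfield_origin_globally_exponentially_stable (N : ℕ) (hN : 0 < N) (lam g : ℝ)
    (hlam : 0 < lam) (hg : 0 < g) (ω : Fin N → Fin N → ℝ) (K : ℝ)
    (hK : K = Finset.univ.sup'
      (Finset.univ_nonempty_iff.mpr (Fin.pos_iff_nonempty.mp hN))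
      (fun i => ∑ j, |F lam (ω i j)|))
    (hcontr : g * lam * K < 1)
    (x : ℝ → Fin N → ℝ)
    (hsol : ∀ t ≥ (0 : ℝ), ∀ i, HasDerivAt (fun s => x s i) (u N lam g ω (x t) i) t) :
    (∀ t ≥ (0 : ℝ),
      Finset.univ.sup'
          (Finset.univ_nonempty_iff.mpr (Fin.pos_iff_nonempty.mp hN))
          (fun i => |x t i|) ≤
        Real.exp (-(1 - g * lam * K) * t) *
          Finset.univ.sup'
            (Finset.univ_nonempty_iff.mpr (Fin.pos_iff_nonempty.mp hN))
            (fun i => |x 0 i|)) ∧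
    (∀ i, Tendsto (fun t => x t i) atTop (nhds 0)) := by
  haveI : Nonempty (Fin N) := Fin.pos_iff_nonempty.mp hN
  have hKi : ∀ i, ∑ j, |F lam (ω i j)| ≤ K := by
    intro i
    rw [hK]
    exact Finset.le_sup' (fun i => ∑ j, |F lam (ω i j)|) (Finset.mem_univ i)
  have hK0 : 0 ≤ K := by
    refine le_trans ?_ (hKi (Classical.arbitrary _))
    exact Finset.sum_nonneg fun j _ => abs_nonneg _
  have hsup : ∀ v : Fin N → ℝ, Finset.univ.sup'
      (Finset.univ_nonempty_iff.mpr (Fin.pos_iff_nonempty.mp hN)) (fun i => |v i|) = ‖v‖ := by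
    intro v
    apply le_antisymm
    · exact Finset.sup'_le _ _ fun i _ => norm_le_pi_norm v i
    · rw [pi_norm_le_iff_of_nonempty]
      intro i
      exact Finset.le_sup' (fun i => |v i|) (Finset.mem_univ i)
  set y : ℝ → Fin N → ℝ := fun t i => Real.exp t * x t i with hy
  set y' : ℝ → Fin N → ℝ :=
    fun t i => Real.exp t * (g * ∑ j, F lam (ω i j) * F lam (x t j)) with hy'
  have hd : ∀ t ≥ (0 : ℝ), HasDerivAt y (y' t) t := by
    intro t ht
    rw [hasDerivAt_pi]
    intro i
    have h := (Real.hasDerivAt_exp t).mul (hsol t ht i)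
    refine h.congr_deriv ?_
    simp only [hy', u]
    ring
  have hny : ∀ t, ‖y t‖ = Real.exp t * ‖x t‖ := by
    intro t
    have : y t = Real.exp t • x t := by
      ext i
      simp [hy]
    rw [this, norm_smul, Real.norm_eq_abs, abs_of_pos (Real.exp_pos t)]
  have hb : ∀ t, ‖y' t‖ ≤ (g * lam * K) * ‖y t‖ := by
    intro t
    rw [pi_norm_le_iff_of_nonneg (by positivity)]
    intro i
    have hs : |∑ j, F lam (ω i j) * F lam (x t j)| ≤ K * (lam * ‖x t‖) := by
      calc |∑ j, F lam (ω i j) * F lam (x t j)|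
          ≤ ∑ j, |F lam (ω i j) * F lam (x t j)| := Finset.abs_sum_le_sum_abs _ _
        _ ≤ ∑ j, |F lam (ω i j)| * (lam * ‖x t‖) := by
            apply Finset.sum_le_sum
            intro j _
            rw [abs_mul]
            have h1 := hop_abs_F_le lam (x t j) hlam
            have h2 : |x t j| ≤ ‖x t‖ := norm_le_pi_norm (x t) j
            have h3 : lam * |x t j| ≤ lam * ‖x t‖ := by gcongr
            exact mul_le_mul_of_nonneg_left (h1.trans h3) (abs_nonneg _)
        _ = (∑ j, |F lam (ω i j)|) * (lam * ‖x t‖) := by rw [Finset.sum_mul]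
        _ ≤ K * (lam * ‖x t‖) := by
            gcongr
            exact hKi i
    rw [hny]
    simp only [hy', Real.norm_eq_abs]
    rw [abs_mul, abs_mul, abs_of_pos (Real.exp_pos t), abs_of_pos hg]
    calc Real.exp t * (g * |∑ j, F lam (ω i j) * F lam (x t j)|)
        ≤ Real.exp t * (g * (K * (lam * ‖x t‖))) := by gcongr
      _ = g * lam * K * (Real.exp t * ‖x t‖) := by ring
  have main : ∀ t ≥ (0 : ℝ), ‖x t‖ ≤ Real.exp (-(1 - g * lam * K) * t) * ‖x 0‖ := by
    intro t ht
    have h := norm_le_gronwallBound_of_norm_deriv_right_le (f := y) (f' := y') (δ := ‖y 0‖)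
      (K := g * lam * K) (ε := 0) (a := 0) (b := t)
      (fun s hs => (hd s hs.1).continuousAt.continuousWithinAt)
      (fun s hs => (hd s hs.1).hasDerivWithinAt) le_rfl
      (fun s _ => by simpa using hb s) t ⟨ht, le_rfl⟩
    rw [gronwallBound_ε0, hny, hny, Real.exp_zero, one_mul, sub_zero] at h
    have e : Real.exp (-(1 - g * lam * K) * t) = Real.exp (-t) * Real.exp (g * lam * K * t) := by
      rw [← Real.exp_add]
      congr 1
      ring
    have e2 : Real.exp (-t) * Real.exp t = 1 := by
      rw [← Real.exp_add]
      simp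
    calc ‖x t‖ = Real.exp (-t) * (Real.exp t * ‖x t‖) := by rw [← mul_assoc, e2, one_mul]
      _ ≤ Real.exp (-t) * (‖x 0‖ * Real.exp (g * lam * K * t)) := by gcongr
      _ = _ := by rw [e]; ring
  refine ⟨?_, ?_⟩
  · intro t ht
    rw [hsup, hsup]
    exact main t ht
  · intro i
    have hlim : Tendsto (fun t : ℝ => Real.exp (-(1 - g * lam * K) * t) * ‖x 0‖) atTop
        (nhds 0) := by
      have h1 : Tendsto (fun t : ℝ => -(1 - g * lam * K) * t) atTop atBot :=
        tendsto_id.const_mul_atTop_of_neg (by linarith)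
      simpa using (Real.tendsto_exp_atBot.comp h1).mul_const ‖x 0‖
    refine squeeze_zero_norm' ?_ hlim
    filter_upwards [eventually_ge_atTop (0 : ℝ)] with t ht
    exact (norm_le_pi_norm (x t) i).trans (main t ht)
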